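/- Let β ∈ ℂ and γ ∈ ℂ with γ ≠ 0, and consider the quotient HVir/ℂC_I of the twisted Heisenberg–Virasoro Lie algebra by the central ideal spanned by C_I. The linear map φ determined by φ(T(n)) = T(n) + β(n+1)·I(n), φ(I(n)) = γ·I(n), φ(C_L) = C_L + 24β·C_{LI} and φ(C_{LI}) = γ·C_{LI} is a Lie algebra automorphism of HVir/ℂC_I. (This underlies the isomorphism L^{HVir}(c_L, c_{LI}) ≅ L^{HVir} sending L̄ ↦ L − ((c_L−2)/24)∂I and Ī ↦ c_{LI}·I.) -/

import Mathlib

/-- The underlying vector space of the quotient `HVir/ℂC_I` of the twisted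
Heisenberg–Virasoro algebra by the central ideal spanned by `C_I`: the first factor records
the coefficients of the `T(n)`, the second the coefficients of the `I(n)`, and the two
scalars the coefficients of `C_L` and `C_{LI}`. -/
def HV0 : Type := (ℤ →₀ ℂ) × (ℤ →₀ ℂ) × ℂ × ℂ

noncomputable instance : AddCommGroup HV0 :=
  inferInstanceAs (AddCommGroup ((ℤ →₀ ℂ) × (ℤ →₀ ℂ) × ℂ × ℂ))
noncomputable instance : Module ℂ HV0 :=
  inferInstanceAs (Module ℂ ((ℤ →₀ ℂ) × (ℤ →₀ ℂ) × ℂ × ℂ))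

/-- The basis vector `T(n)` of `HVir/ℂC_I`. -/
noncomputable def Tg0 (n : ℤ) : HV0 := (Finsupp.single n 1, 0, 0, 0)
/-- The basis vector `I(n)` of `HVir/ℂC_I`. -/
noncomputable def Ig0 (n : ℤ) : HV0 := (0, Finsupp.single n 1, 0, 0)
/-- The central basis vector `C_L` of `HVir/ℂC_I`. -/
noncomputable def CL0 : HV0 := (0, 0, 1, 0)
/-- The central basis vector `C_{LI}` of `HVir/ℂC_I`. -/
noncomputable def CLI0 : HV0 := (0, 0, 0, 1)

/-- The Lie bracket induced on the quotient `HVir/ℂC_I`: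
`[T(n),T(m)] = (n−m)T(n+m) + δ_{n,−m}((n³−n)/12)C_L`,
`[T(n),I(m)] = −m·I(n+m) − δ_{n,−m}(n²+n)C_{LI}`, `[I(n),I(m)] = 0`,
with `C_L, C_{LI}` central. -/
noncomputable def hvBr0 (u v : HV0) : HV0 :=
  (u.1.sum fun n a => v.1.sum fun m b =>
      (a * b * ((n : ℂ) - m)) • Finsupp.single (n + m) (1 : ℂ),
   (u.1.sum fun n a => v.2.1.sum fun m b =>
      (a * b * (-(m : ℂ))) • Finsupp.single (n + m) (1 : ℂ))
     + (u.2.1.sum fun n a => v.1.sum fun m b =>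
      (a * b * (n : ℂ)) • Finsupp.single (n + m) (1 : ℂ)),
   u.1.sum fun n a => v.1.sum fun m b =>
      if n + m = 0 then a * b * (((n : ℂ) ^ 3 - n) / 12) else 0,
   (u.1.sum fun n a => v.2.1.sum fun m b =>
      if n + m = 0 then -(a * b * ((n : ℂ) ^ 2 + n)) else 0)
     + (u.2.1.sum fun n a => v.1.sum fun m b =>
      if n + m = 0 then a * b * ((m : ℂ) ^ 2 + m) else 0))

/-- The bilinear extension to `ℤ →₀ ℂ` of a function on pairs of basis vectors. -/
noncomputable def finsuppBilin {M : Type*} [AddCommGroup M] [Module ℂ M] (g : ℤ → ℤ → M) :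
    (ℤ →₀ ℂ) →ₗ[ℂ] (ℤ →₀ ℂ) →ₗ[ℂ] M :=
  Finsupp.linearCombination ℂ fun n => Finsupp.linearCombination ℂ (g n)

theorem finsuppBilin_apply {M : Type*} [AddCommGroup M] [Module ℂ M] (g : ℤ → ℤ → M)
    (u v : ℤ →₀ ℂ) :
    finsuppBilin g u v = u.sum fun n a => v.sum fun m b => (a * b) • g n m := by
  simp only [finsuppBilin, Finsupp.linearCombination_apply, Finsupp.sum, LinearMap.sum_apply,
    LinearMap.smul_apply, Finset.smul_sum, mul_smul]

theorem finsuppBilin_single {M : Type*} [AddCommGroup M] [Module ℂ M] (g : ℤ → ℤ → M)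
    (n m : ℤ) (a b : ℂ) :
    finsuppBilin g (Finsupp.single n a) (Finsupp.single m b) = (a * b) • g n m := by
  simp [finsuppBilin, mul_smul]

/-- The diagonal operator `e_n ↦ (n + 1) e_n` on `ℤ →₀ ℂ`. -/
noncomputable def degreeSucc : (ℤ →₀ ℂ) →ₗ[ℂ] (ℤ →₀ ℂ) :=
  Finsupp.linearCombination ℂ fun n => Finsupp.single n ((n : ℂ) + 1)

theorem degreeSucc_single (n : ℤ) (a : ℂ) :
    degreeSucc (Finsupp.single n a) = Finsupp.single n (a * ((n : ℂ) + 1)) := by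
  rw [degreeSucc, Finsupp.linearCombination_single, Finsupp.smul_single, smul_eq_mul]

/-- The `T`-component of the bracket of two combinations of the `T(n)`. -/
noncomputable def brTT : (ℤ →₀ ℂ) →ₗ[ℂ] (ℤ →₀ ℂ) →ₗ[ℂ] (ℤ →₀ ℂ) :=
  finsuppBilin fun n m => Finsupp.single (n + m) ((n : ℂ) - m)

/-- The `I`-component of the bracket of a combination of the `T(n)` with one of the `I(m)`. -/
noncomputable def brTI : (ℤ →₀ ℂ) →ₗ[ℂ] (ℤ →₀ ℂ) →ₗ[ℂ] (ℤ →₀ ℂ) :=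
  finsuppBilin fun n m => Finsupp.single (n + m) (-(m : ℂ))

/-- The `I`-component of the bracket of a combination of the `I(n)` with one of the `T(m)`. -/
noncomputable def brIT : (ℤ →₀ ℂ) →ₗ[ℂ] (ℤ →₀ ℂ) →ₗ[ℂ] (ℤ →₀ ℂ) :=
  finsuppBilin fun n m => Finsupp.single (n + m) (n : ℂ)

/-- The `C_L`-component of the bracket of two combinations of the `T(n)`. -/
noncomputable def cocycleTT : (ℤ →₀ ℂ) →ₗ[ℂ] (ℤ →₀ ℂ) →ₗ[ℂ] ℂ :=
  finsuppBilin fun n m => if n + m = 0 then ((n : ℂ) ^ 3 - n) / 12 else 0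

/-- The `C_{LI}`-component of the bracket of a combination of the `T(n)` with one of the
`I(m)`. -/
noncomputable def cocycleTI : (ℤ →₀ ℂ) →ₗ[ℂ] (ℤ →₀ ℂ) →ₗ[ℂ] ℂ :=
  finsuppBilin fun n m => if n + m = 0 then -((n : ℂ) ^ 2 + n) else 0

/-- The `C_{LI}`-component of the bracket of a combination of the `I(n)` with one of the
`T(m)`. -/
noncomputable def cocycleIT : (ℤ →₀ ℂ) →ₗ[ℂ] (ℤ →₀ ℂ) →ₗ[ℂ] ℂ :=
  finsuppBilin fun n m => if n + m = 0 then (m : ℂ) ^ 2 + m else 0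

theorem hvBr0_eq (u v : HV0) :
    hvBr0 u v = (brTT u.1 v.1, brTI u.1 v.2.1 + brIT u.2.1 v.1, cocycleTT u.1 v.1,
      cocycleTI u.1 v.2.1 + cocycleIT u.2.1 v.1) := by
  simp only [hvBr0, brTT, brTI, brIT, cocycleTT, cocycleTI, cocycleIT, finsuppBilin_apply,
    Finsupp.smul_single, smul_eq_mul, mul_one, mul_ite, mul_zero, mul_neg]
  rfl

theorem degreeSucc_brTT (u v : ℤ →₀ ℂ) :
    degreeSucc (brTT u v) = brTI u (degreeSucc v) + brIT (degreeSucc u) v := by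
  have h : brTT.compr₂ degreeSucc = brTI.compl₂ degreeSucc + brIT ∘ₗ degreeSucc := by
    refine Finsupp.lhom_ext fun n a => Finsupp.lhom_ext fun m b => ?_
    simp only [LinearMap.compr₂_apply, LinearMap.add_apply, LinearMap.compl₂_apply,
      LinearMap.comp_apply, degreeSucc_single, brTT, brTI, brIT, finsuppBilin_single,
      Finsupp.smul_single, smul_eq_mul, ← Finsupp.single_add]
    congr 1
    push_cast
    ring
  exact LinearMap.congr_fun (LinearMap.congr_fun h u) v

theorem cocycleTT_mul (u v : ℤ →₀ ℂ) :
    24 * cocycleTT u v = cocycleTI u (degreeSucc v) + cocycleIT (degreeSucc u) v := by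
  have h : (24 : ℂ) • cocycleTT = cocycleTI.compl₂ degreeSucc + cocycleIT ∘ₗ degreeSucc := by
    refine Finsupp.lhom_ext fun n a => Finsupp.lhom_ext fun m b => ?_
    simp only [LinearMap.smul_apply, LinearMap.add_apply, LinearMap.compl₂_apply,
      LinearMap.comp_apply, degreeSucc_single, cocycleTT, cocycleTI, cocycleIT,
      finsuppBilin_single, smul_eq_mul]
    split_ifs with hnm
    · obtain rfl : m = -n := by lia
      push_cast
      ring
    · simp
  exact LinearMap.congr_fun (LinearMap.congr_fun h u) v

/-- The automorphism `T(n) ↦ T(n) + β(n+1)I(n)`, `I(n) ↦ γI(n)`, `C_L ↦ C_L + 24βC_{LI}`,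
`C_{LI} ↦ γC_{LI}`, as a linear equivalence. -/
noncomputable def shiftScale (β γ : ℂ) (hγ : γ ≠ 0) : HV0 ≃ₗ[ℂ] HV0 where
  toFun u := (u.1, β • degreeSucc u.1 + γ • u.2.1, u.2.2.1, 24 * β * u.2.2.1 + γ * u.2.2.2)
  invFun u := (u.1, γ⁻¹ • (u.2.1 - β • degreeSucc u.1), u.2.2.1,
    γ⁻¹ * (u.2.2.2 - 24 * β * u.2.2.1))
  map_add' u v := by
    refine Prod.ext rfl (Prod.ext ?_ (Prod.ext rfl ?_))
    · change β • degreeSucc (u.1 + v.1) + γ • (u.2.1 + v.2.1) =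
        (β • degreeSucc u.1 + γ • u.2.1) + (β • degreeSucc v.1 + γ • v.2.1)
      rw [map_add]
      module
    · change 24 * β * (u.2.2.1 + v.2.2.1) + γ * (u.2.2.2 + v.2.2.2) =
        (24 * β * u.2.2.1 + γ * u.2.2.2) + (24 * β * v.2.2.1 + γ * v.2.2.2)
      ring
  map_smul' c u := by
    refine Prod.ext rfl (Prod.ext ?_ (Prod.ext rfl ?_))
    · change β • degreeSucc (c • u.1) + γ • (c • u.2.1) = c • (β • degreeSucc u.1 + γ • u.2.1)
      rw [map_smul]
      module
    · change 24 * β * (c * u.2.2.1) + γ * (c * u.2.2.2) =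
        c * (24 * β * u.2.2.1 + γ * u.2.2.2)
      ring
  left_inv u := by
    refine Prod.ext rfl (Prod.ext ?_ (Prod.ext rfl ?_))
    · simp [inv_smul_smul₀ hγ]
    · simp [inv_mul_cancel_left₀ hγ]
  right_inv u := by
    refine Prod.ext rfl (Prod.ext ?_ (Prod.ext rfl ?_))
    · simp [smul_inv_smul₀ hγ]
    · simp [mul_inv_cancel_left₀ hγ]

theorem shiftScale_hvBr0 (β γ : ℂ) (hγ : γ ≠ 0) (u v : HV0) :
    shiftScale β γ hγ (hvBr0 u v) = hvBr0 (shiftScale β γ hγ u) (shiftScale β γ hγ v) := by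
  rw [hvBr0_eq, hvBr0_eq]
  refine Prod.ext rfl (Prod.ext ?_ (Prod.ext rfl ?_))
  · change β • degreeSucc (brTT u.1 v.1) + γ • (brTI u.1 v.2.1 + brIT u.2.1 v.1) =
      brTI u.1 (β • degreeSucc v.1 + γ • v.2.1) + brIT (β • degreeSucc u.1 + γ • u.2.1) v.1
    simp only [degreeSucc_brTT, map_add, map_smul, LinearMap.add_apply, LinearMap.smul_apply]
    module
  · change 24 * β * cocycleTT u.1 v.1 + γ * (cocycleTI u.1 v.2.1 + cocycleIT u.2.1 v.1) =
      cocycleTI u.1 (β • degreeSucc v.1 + γ • v.2.1) +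
        cocycleIT (β • degreeSucc u.1 + γ • u.2.1) v.1
    simp only [map_add, map_smul, LinearMap.add_apply, LinearMap.smul_apply, smul_eq_mul]
    linear_combination β * cocycleTT_mul u.1 v.1

/-- for `β ∈ ℂ` and `γ ∈ ℂ`, `γ ≠ 0`, the linear map `φ` of `HVir/ℂC_I`
determined by `φ(T(n)) = T(n) + β(n+1)·I(n)`, `φ(I(n)) = γ·I(n)`,
`φ(C_L) = C_L + 24β·C_{LI}`, `φ(C_{LI}) = γ·C_{LI}` is a Lie algebra automorphism of
`HVir/ℂC_I`. -/
theorem statement18 (β γ : ℂ) (hγ : γ ≠ 0) :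
    ∃ φ : HV0 ≃ₗ[ℂ] HV0,
      (∀ u v : HV0, φ (hvBr0 u v) = hvBr0 (φ u) (φ v)) ∧
      (∀ n : ℤ, φ (Tg0 n) = Tg0 n + (β * ((n : ℂ) + 1)) • Ig0 n) ∧
      (∀ n : ℤ, φ (Ig0 n) = γ • Ig0 n) ∧
      φ CL0 = CL0 + (24 * β) • CLI0 ∧
      φ CLI0 = γ • CLI0 := by
  refine ⟨shiftScale β γ hγ, shiftScale_hvBr0 β γ hγ, fun n => ?_, fun n => ?_, ?_, ?_⟩
  · refine Prod.ext ?_ (Prod.ext ?_ (Prod.ext ?_ ?_))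
    · change Finsupp.single n (1 : ℂ) = Finsupp.single n 1 + (β * ((n : ℂ) + 1)) • 0
      simp
    · change β • degreeSucc (Finsupp.single n 1) + γ • 0 =
        0 + (β * ((n : ℂ) + 1)) • Finsupp.single n 1
      rw [degreeSucc_single, smul_zero, add_zero, zero_add, Finsupp.smul_single,
        Finsupp.smul_single, smul_eq_mul, smul_eq_mul, one_mul, mul_one]
    · change (0 : ℂ) = 0 + (β * ((n : ℂ) + 1)) * 0
      simp
    · change 24 * β * 0 + γ * 0 = 0 + (β * ((n : ℂ) + 1)) * 0
      simp
  · refine Prod.ext ?_ (Prod.ext ?_ (Prod.ext ?_ ?_))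
    · change (0 : ℤ →₀ ℂ) = γ • 0
      simp
    · change β • degreeSucc 0 + γ • Finsupp.single n 1 = γ • Finsupp.single n 1
      simp
    · change (0 : ℂ) = γ * 0
      simp
    · change 24 * β * 0 + γ * 0 = γ * 0
      simp
  · refine Prod.ext ?_ (Prod.ext ?_ (Prod.ext ?_ ?_))
    · change (0 : ℤ →₀ ℂ) = 0 + (24 * β) • 0
      simp
    · change β • degreeSucc 0 + γ • 0 = 0 + (24 * β) • 0
      simp
    · change (1 : ℂ) = 1 + 24 * β * 0
      simp
    · change 24 * β * 1 + γ * 0 = 0 + 24 * β * 1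
      simp
  · refine Prod.ext ?_ (Prod.ext ?_ (Prod.ext ?_ ?_))
    · change (0 : ℤ →₀ ℂ) = γ • 0
      simp
    · change β • degreeSucc 0 + γ • 0 = γ • 0
      simp
    · change (0 : ℂ) = γ * 0
      simp
    · change 24 * β * 0 + γ * 1 = γ * 1
      simp
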